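/- arXiv:1407.3928 — 4 statements merged into one kernel-verified Lean document; each statement's English description precedes it below -/
import Mathlib

section
/- The natural map H_BC → H_A induced by the identity is injective if and only if it is an isomorphism. Equivalently: ker ∂ ∩ ker ∂̄ ∩ (im ∂ + im ∂̄) = im(∂∘∂̄) holds if and only if the induced map (ker ∂ ∩ ker ∂̄)/im(∂∘∂̄) → ker(∂∘∂̄)/(im ∂ + im ∂̄) is bijective. -/
open LinearMap Submodule

section

variable {K V : Type*} [Field K] [AddCommGroup V] [Module K V]

/-- Bott–Chern cocycles: `ker ∂ ∩ ker ∂̄`. -/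
def ZBC (p q : V →ₗ[K] V) : Submodule K V := ker p ⊓ ker q

/-- Bott–Chern coboundaries: `im (∂∘∂̄)`. -/
def BBC (p q : V →ₗ[K] V) : Submodule K V := range (p ∘ₗ q)

/-- Aeppli cocycles: `ker (∂∘∂̄)`. -/
def ZA (p q : V →ₗ[K] V) : Submodule K V := ker (p ∘ₗ q)

/-- Aeppli coboundaries: `im ∂ + im ∂̄`. -/
def BA (p q : V →ₗ[K] V) : Submodule K V := range p ⊔ range q

/-- Bott–Chern cohomology `(ker ∂ ∩ ker ∂̄)/im(∂∘∂̄)`. -/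
abbrev HBC (p q : V →ₗ[K] V) := ↥(ZBC p q) ⧸ ((BBC p q).comap (ZBC p q).subtype)

/-- Aeppli cohomology `ker(∂∘∂̄)/(im ∂ + im ∂̄)`. -/
abbrev HA (p q : V →ₗ[K] V) := ↥(ZA p q) ⧸ ((BA p q).comap (ZA p q).subtype)

theorem ZBC_le_ZA (p q : V →ₗ[K] V) : ZBC p q ≤ ZA p q := by
  intro x hx
  obtain ⟨h1, h2⟩ := Submodule.mem_inf.mp hx
  simp only [ZA, mem_ker, comp_apply] at *
  rw [h2, map_zero]

theorem BBC_le_BA (p q : V →ₗ[K] V) : BBC p q ≤ BA p q := by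
  rintro x ⟨u, rfl⟩
  exact Submodule.mem_sup_left ⟨q u, rfl⟩

/-- The natural map `H_BC → H_A` induced by the identity. -/
def iotaBCA (p q : V →ₗ[K] V) : HBC p q →ₗ[K] HA p q :=
  Submodule.liftQ _
    ((Submodule.mkQ _) ∘ₗ Submodule.inclusion (ZBC_le_ZA p q)) (by
      intro y hy
      rw [Submodule.mem_comap] at hy
      simp only [LinearMap.mem_ker, LinearMap.comp_apply, Submodule.mkQ_apply,
        Submodule.Quotient.mk_eq_zero, Submodule.mem_comap]
      exact BBC_le_BA p q hy)

end

/-- The natural map `H_BC → H_A` is injective if and only if it is an isomorphism;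
equivalently, `ker ∂ ∩ ker ∂̄ ∩ (im ∂ + im ∂̄) = im (∂∘∂̄)` holds if and only if the
induced map is bijective. -/
theorem stmt3 {K V : Type*} [Field K] [AddCommGroup V] [Module K V]
    (p q : V →ₗ[K] V)
    (hp : p ∘ₗ p = 0) (hq : q ∘ₗ q = 0) (hpq : p ∘ₗ q + q ∘ₗ p = 0) :
    (Function.Injective (iotaBCA p q) ↔ Function.Bijective (iotaBCA p q)) ∧
    ((ker p ⊓ ker q ⊓ (range p ⊔ range q) = range (p ∘ₗ q)) ↔
      Function.Bijective (iotaBCA p q)) := by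
  have hp' : ∀ x, p (p x) = 0 := fun x => LinearMap.congr_fun hp x
  have hq' : ∀ x, q (q x) = 0 := fun x => LinearMap.congr_fun hq x
  have hpq' : ∀ x, q (p x) = - p (q x) := fun x =>
    eq_neg_of_add_eq_zero_right (LinearMap.congr_fun hpq x)
  have key : (ker p ⊓ ker q ⊓ (range p ⊔ range q) = range (p ∘ₗ q)) →
      Function.Surjective (iotaBCA p q) := by
    intro h y
    obtain ⟨⟨x, hx⟩, rfl⟩ := Submodule.Quotient.mk_surjective _ y
    have hx' : p (q x) = 0 := hx
    have h1 : p x ∈ range (p ∘ₗ q) := by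
      rw [← h]
      refine ⟨⟨hp' x, ?_⟩, Submodule.mem_sup_left ⟨x, rfl⟩⟩
      change q (p x) = 0
      rw [hpq', hx', neg_zero]
    have h2 : q x ∈ range (p ∘ₗ q) := by
      rw [← h]
      exact ⟨⟨hx', hq' x⟩, Submodule.mem_sup_right ⟨x, rfl⟩⟩
    obtain ⟨u, hu⟩ := h1
    obtain ⟨v, hv⟩ := h2
    rw [LinearMap.comp_apply] at hu hv
    have hz : x - q u + p v ∈ ZBC p q := by
      refine ⟨?_, ?_⟩
      · change p (x - q u + p v) = 0
        rw [map_add, map_sub, hp', hu]; simp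
      · change q (x - q u + p v) = 0
        rw [map_add, map_sub, hq', hpq', hv]; simp
    refine ⟨Submodule.Quotient.mk ⟨_, hz⟩, ?_⟩
    refine (Submodule.Quotient.eq _).2 ?_
    change x - q u + p v - x ∈ range p ⊔ range q
    have e : x - q u + p v - x = p v + q (-u) := by rw [map_neg]; abel
    rw [e]
    exact Submodule.add_mem_sup ⟨v, rfl⟩ ⟨-u, rfl⟩
  have inj : Function.Injective (iotaBCA p q) ↔
      (ker p ⊓ ker q ⊓ (range p ⊔ range q) = range (p ∘ₗ q)) := by
    rw [injective_iff_map_eq_zero]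
    constructor
    · intro h
      apply le_antisymm
      · rintro x ⟨hx, hb⟩
        have := h (Submodule.Quotient.mk ⟨x, hx⟩) ((Submodule.Quotient.mk_eq_zero _).2 hb)
        have h3 := (Submodule.Quotient.mk_eq_zero _).1 this
        exact h3
      · rintro x ⟨u, rfl⟩
        refine ⟨⟨hp' _, ?_⟩, Submodule.mem_sup_left ⟨q u, rfl⟩⟩
        change q (p (q u)) = 0
        rw [hpq', hq', map_zero, neg_zero]
    · intro h y hy
      obtain ⟨⟨x, hx⟩, rfl⟩ := Submodule.Quotient.mk_surjective _ y
      have hb : x ∈ range p ⊔ range q := by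
        have h3 := (Submodule.Quotient.mk_eq_zero ((BA p q).comap (ZA p q).subtype)
          (x := (⟨x, ZBC_le_ZA p q hx⟩ : ZA p q))).1 hy
        exact h3
      refine (Submodule.Quotient.mk_eq_zero _).2 ?_
      change x ∈ range (p ∘ₗ q)
      rw [← h]
      exact ⟨hx, hb⟩
  exact ⟨⟨fun h => ⟨h, key (inj.1 h)⟩, fun h => h.1⟩,
    ⟨fun h => ⟨inj.2 h, key h⟩, fun h => inj.1 h.1⟩⟩
end

section
/- The natural map H_BC → H_A induced by the identity is injective if and only if both natural maps H_BC → H_∂ and H_BC → H_∂̄ induced by the identity are injective. Equivalently: ker ∂ ∩ ker ∂̄ ∩ (im ∂ + im ∂̄) = im(∂∘∂̄) holds if and only if ker ∂ ∩ ker ∂̄ ∩ im ∂ ⊆ im(∂∘∂̄) and ker ∂ ∩ ker ∂̄ ∩ im ∂̄ ⊆ im(∂∘∂̄). -/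
open LinearMap Submodule

section

variable {K V : Type*} [Field K] [AddCommGroup V] [Module K V]

/-- `∂`-cohomology `ker ∂ / im ∂`. -/
abbrev Hdel (p : V →ₗ[K] V) := ↥(ker p) ⧸ ((range p).comap (ker p).subtype)

/-- The natural map `H_BC → H_∂` induced by the identity. -/
def iotaBCdel (p q : V →ₗ[K] V) : HBC p q →ₗ[K] Hdel p :=
  Submodule.liftQ _
    ((Submodule.mkQ _) ∘ₗ Submodule.inclusion (inf_le_left : ZBC p q ≤ ker p)) (by
      intro y hy
      rw [Submodule.mem_comap] at hy
      simp only [LinearMap.mem_ker, LinearMap.comp_apply, Submodule.mkQ_apply,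
        Submodule.Quotient.mk_eq_zero, Submodule.mem_comap]
      obtain ⟨u, hu⟩ := hy
      exact ⟨q u, hu⟩)

/-- The natural map `H_BC → H_∂̄` induced by the identity (it uses the
anticommutation `∂∘∂̄ + ∂̄∘∂ = 0`). -/
def iotaBCdelbar (p q : V →ₗ[K] V) (hpq : p ∘ₗ q + q ∘ₗ p = 0) :
    HBC p q →ₗ[K] Hdel q :=
  Submodule.liftQ _
    ((Submodule.mkQ _) ∘ₗ Submodule.inclusion (inf_le_right : ZBC p q ≤ ker q)) (by
      intro y hy
      rw [Submodule.mem_comap] at hy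
      simp only [LinearMap.mem_ker, LinearMap.comp_apply, Submodule.mkQ_apply,
        Submodule.Quotient.mk_eq_zero, Submodule.mem_comap]
      obtain ⟨u, hu⟩ := hy
      refine ⟨-(p u), ?_⟩
      have h2 : p (q u) + q (p u) = 0 := by
        have := LinearMap.congr_fun hpq u; simpa using this
      have hu' : p (q u) = (y : V) := hu
      show q (-(p u)) = (y : V)
      rw [map_neg, ← hu']
      exact neg_eq_of_add_eq_zero_left h2)

end

/-- The natural map `H_BC → H_A` is injective if and only if both natural maps
`H_BC → H_∂` and `H_BC → H_∂̄` are injective; equivalently,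
`ker ∂ ∩ ker ∂̄ ∩ (im ∂ + im ∂̄) = im(∂∘∂̄)` holds iff
`ker ∂ ∩ ker ∂̄ ∩ im ∂ ⊆ im(∂∘∂̄)` and `ker ∂ ∩ ker ∂̄ ∩ im ∂̄ ⊆ im(∂∘∂̄)`. -/
theorem stmt4 {K V : Type*} [Field K] [AddCommGroup V] [Module K V]
    (p q : V →ₗ[K] V)
    (hp : p ∘ₗ p = 0) (hq : q ∘ₗ q = 0) (hpq : p ∘ₗ q + q ∘ₗ p = 0) :
    (Function.Injective (iotaBCA p q) ↔
      (Function.Injective (iotaBCdel p q) ∧ Function.Injective (iotaBCdelbar p q hpq))) ∧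
    ((ker p ⊓ ker q ⊓ (range p ⊔ range q) = range (p ∘ₗ q)) ↔
      (ker p ⊓ ker q ⊓ range p ≤ range (p ∘ₗ q) ∧
        ker p ⊓ ker q ⊓ range q ≤ range (p ∘ₗ q))) := by
  have hpp : ∀ x, p (p x) = 0 := fun x => LinearMap.congr_fun hp x
  have hqq : ∀ x, q (q x) = 0 := fun x => LinearMap.congr_fun hq x
  have hanti : ∀ x, p (q x) + q (p x) = 0 := fun x => LinearMap.congr_fun hpq x
  have hle : range (p ∘ₗ q) ≤ ker p ⊓ ker q ⊓ (range p ⊔ range q) := by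
    rintro x ⟨u, rfl⟩
    refine ⟨⟨?_, ?_⟩, Submodule.mem_sup_left ⟨q u, rfl⟩⟩
    · exact hpp (q u)
    · have h := hanti (q u)
      rw [hqq, map_zero, zero_add] at h
      exact h
  have key : (ker p ⊓ ker q ⊓ (range p ⊔ range q) = range (p ∘ₗ q)) ↔
      (ker p ⊓ ker q ⊓ range p ≤ range (p ∘ₗ q) ∧
        ker p ⊓ ker q ⊓ range q ≤ range (p ∘ₗ q)) := by
    constructor
    · intro h
      rw [← h]
      exact ⟨inf_le_inf_left _ le_sup_left, inf_le_inf_left _ le_sup_right⟩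
    · rintro ⟨h1, h2⟩
      refine le_antisymm ?_ hle
      rintro x ⟨⟨hx1, hx2⟩, hx⟩
      obtain ⟨_, ⟨a, rfl⟩, _, ⟨b, rfl⟩, rfl⟩ := Submodule.mem_sup.mp hx
      have e1 : p (q b) = 0 := by
        have h : p (p a + q b) = 0 := hx1
        rwa [map_add, hpp, zero_add] at h
      have e2 : q (p a) = 0 := by
        have h : q (p a + q b) = 0 := hx2
        rwa [map_add, hqq, add_zero] at h
      exact add_mem (h1 ⟨⟨hpp a, e2⟩, ⟨a, rfl⟩⟩) (h2 ⟨⟨e1, hqq b⟩, ⟨b, rfl⟩⟩)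
  have iA : Function.Injective (iotaBCA p q) ↔
      ker p ⊓ ker q ⊓ (range p ⊔ range q) ≤ range (p ∘ₗ q) := by
    rw [injective_iff_map_eq_zero]
    constructor
    · rintro h x ⟨hx, hr⟩
      have := h (Submodule.Quotient.mk ⟨x, hx⟩) ((Submodule.Quotient.mk_eq_zero _).2 hr)
      have h2 := (Submodule.Quotient.mk_eq_zero _).1 this
      exact h2
    · intro h y
      obtain ⟨⟨x, hx⟩, rfl⟩ := Submodule.Quotient.mk_surjective _ y
      intro hy
      have h2 := (Submodule.Quotient.mk_eq_zero ((BA p q).comap (ZA p q).subtype)).1 hy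
      exact (Submodule.Quotient.mk_eq_zero _).2 (h ⟨hx, h2⟩)
  have iP : Function.Injective (iotaBCdel p q) ↔
      ker p ⊓ ker q ⊓ range p ≤ range (p ∘ₗ q) := by
    rw [injective_iff_map_eq_zero]
    constructor
    · rintro h x ⟨hx, hr⟩
      have := h (Submodule.Quotient.mk ⟨x, hx⟩) ((Submodule.Quotient.mk_eq_zero _).2 hr)
      have h2 := (Submodule.Quotient.mk_eq_zero _).1 this
      exact h2
    · intro h y
      obtain ⟨⟨x, hx⟩, rfl⟩ := Submodule.Quotient.mk_surjective _ y
      intro hy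
      have h2 := (Submodule.Quotient.mk_eq_zero ((range p).comap (ker p).subtype)).1 hy
      exact (Submodule.Quotient.mk_eq_zero _).2 (h ⟨hx, h2⟩)
  have iQ : Function.Injective (iotaBCdelbar p q hpq) ↔
      ker p ⊓ ker q ⊓ range q ≤ range (p ∘ₗ q) := by
    rw [injective_iff_map_eq_zero]
    constructor
    · rintro h x ⟨hx, hr⟩
      have := h (Submodule.Quotient.mk ⟨x, hx⟩) ((Submodule.Quotient.mk_eq_zero _).2 hr)
      have h2 := (Submodule.Quotient.mk_eq_zero _).1 this
      exact h2
    · intro h y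
      obtain ⟨⟨x, hx⟩, rfl⟩ := Submodule.Quotient.mk_surjective _ y
      intro hy
      have h2 := (Submodule.Quotient.mk_eq_zero ((range q).comap (ker q).subtype)).1 hy
      exact (Submodule.Quotient.mk_eq_zero _).2 (h ⟨hx, h2⟩)
  refine ⟨?_, key⟩
  rw [iA, iP, iQ, ← key]
  exact ⟨fun h => le_antisymm h hle, fun h => h.le⟩
end

section
/- The natural map H_BC → H_A induced by the identity is injective if and only if both natural maps H_∂ → H_A and H_∂̄ → H_A induced by the identity are surjective. Equivalently: ker ∂ ∩ ker ∂̄ ∩ (im ∂ + im ∂̄) = im(∂∘∂̄) holds if and only if ker(∂∘∂̄) ⊆ ker ∂ + im ∂̄ and ker(∂∘∂̄) ⊆ ker ∂̄ + im ∂. -/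
open LinearMap Submodule

section

variable {K V : Type*} [Field K] [AddCommGroup V] [Module K V]

theorem kerdel_le_ZA (p q : V →ₗ[K] V) (hpq : p ∘ₗ q + q ∘ₗ p = 0) :
    ker p ≤ ZA p q := by
  intro x hx
  rw [LinearMap.mem_ker] at hx
  have h2 : p (q x) + q (p x) = 0 := by
    have := LinearMap.congr_fun hpq x; simpa using this
  have : p (q x) = 0 := by rw [hx, map_zero, add_zero] at h2; exact h2
  simpa [ZA, LinearMap.mem_ker] using this

theorem kerdelbar_le_ZA (p q : V →ₗ[K] V) : ker q ≤ ZA p q := by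
  intro x hx
  rw [LinearMap.mem_ker] at hx
  simp [ZA, LinearMap.mem_ker, hx]

/-- The natural map `H_∂ → H_A` induced by the identity (it uses the
anticommutation `∂∘∂̄ + ∂̄∘∂ = 0`). -/
def iotadelA (p q : V →ₗ[K] V) (hpq : p ∘ₗ q + q ∘ₗ p = 0) :
    (↥(ker p) ⧸ ((range p).comap (ker p).subtype)) →ₗ[K] HA p q :=
  Submodule.liftQ _
    ((Submodule.mkQ _) ∘ₗ Submodule.inclusion (kerdel_le_ZA p q hpq)) (by
      intro y hy
      rw [Submodule.mem_comap] at hy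
      simp only [LinearMap.mem_ker, LinearMap.comp_apply, Submodule.mkQ_apply,
        Submodule.Quotient.mk_eq_zero, Submodule.mem_comap]
      exact Submodule.mem_sup_left hy)

/-- The natural map `H_∂̄ → H_A` induced by the identity. -/
def iotadelbarA (p q : V →ₗ[K] V) :
    (↥(ker q) ⧸ ((range q).comap (ker q).subtype)) →ₗ[K] HA p q :=
  Submodule.liftQ _
    ((Submodule.mkQ _) ∘ₗ Submodule.inclusion (kerdelbar_le_ZA p q)) (by
      intro y hy
      rw [Submodule.mem_comap] at hy
      simp only [LinearMap.mem_ker, LinearMap.comp_apply, Submodule.mkQ_apply,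
        Submodule.Quotient.mk_eq_zero, Submodule.mem_comap]
      exact Submodule.mem_sup_right hy)

end

theorem aux_core {K V : Type*} [Field K] [AddCommGroup V] [Module K V]
    (p q : V →ₗ[K] V)
    (hp : p ∘ₗ p = 0) (hq : q ∘ₗ q = 0) (hpq : p ∘ₗ q + q ∘ₗ p = 0) :
    ((ker p ⊓ ker q ⊓ (range p ⊔ range q) = range (p ∘ₗ q)) ↔
      (ker (p ∘ₗ q) ≤ ker p ⊔ range q ∧ ker (p ∘ₗ q) ≤ ker q ⊔ range p)) := by
  have hp' : ∀ x, p (p x) = 0 := fun x => LinearMap.congr_fun hp x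
  have hq' : ∀ x, q (q x) = 0 := fun x => LinearMap.congr_fun hq x
  have hpq' : ∀ x, q (p x) = - p (q x) := fun x =>
    eq_neg_of_add_eq_zero_right (LinearMap.congr_fun hpq x)
  constructor
  · intro h
    constructor
    · intro x hx
      have hx' : p (q x) = 0 := hx
      have : p x ∈ range (p ∘ₗ q) := by
        rw [← h]
        refine ⟨⟨hp' x, ?_⟩, mem_sup_left ⟨x, rfl⟩⟩
        change q (p x) = 0
        rw [hpq', hx', neg_zero]
      obtain ⟨y, hy⟩ := this
      have hy' : p (q y) = p x := hy
      refine mem_sup.2 ⟨x - q y, ?_, q y, ⟨y, rfl⟩, by abel⟩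
      rw [LinearMap.mem_ker, map_sub, hy', sub_self]
    · intro x hx
      have hx' : p (q x) = 0 := hx
      have : q x ∈ range (p ∘ₗ q) := by
        rw [← h]
        exact ⟨⟨hx', hq' x⟩, mem_sup_right ⟨x, rfl⟩⟩
      obtain ⟨y, hy⟩ := this
      have hy' : p (q y) = q x := hy
      refine mem_sup.2 ⟨x + p y, ?_, p (-y), ⟨-y, rfl⟩, by rw [map_neg]; abel⟩
      rw [LinearMap.mem_ker, map_add, hpq', hy', add_neg_cancel]
  · rintro ⟨h1, h2⟩
    apply le_antisymm
    · rintro z ⟨⟨hz1, hz2⟩, hz3⟩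
      obtain ⟨_, ⟨a, rfl⟩, _, ⟨b, rfl⟩, rfl⟩ := mem_sup.1 hz3
      have e1 : p (p a + q b) = 0 := hz1
      have e2 : q (p a + q b) = 0 := hz2
      rw [map_add, hp', zero_add] at e1
      rw [map_add, hq', add_zero, hpq', neg_eq_zero] at e2
      obtain ⟨a', ha', _, ⟨c, rfl⟩, rfl⟩ := mem_sup.1 (h1 (show a ∈ ker (p ∘ₗ q) from e2))
      obtain ⟨b', hb', _, ⟨e, rfl⟩, rfl⟩ := mem_sup.1 (h2 (show b ∈ ker (p ∘ₗ q) from e1))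
      rw [LinearMap.mem_ker] at ha' hb'
      refine ⟨c - e, ?_⟩
      simp only [LinearMap.comp_apply, map_sub, map_add, ha', hb', hpq']
      abel
    · rintro _ ⟨x, rfl⟩
      refine ⟨⟨hp' _, ?_⟩, mem_sup_left ⟨q x, rfl⟩⟩
      change q (p (q x)) = 0
      rw [hpq', hq', map_zero, neg_zero]

theorem aux_inj {K V : Type*} [Field K] [AddCommGroup V] [Module K V]
    (p q : V →ₗ[K] V) (hp : p ∘ₗ p = 0) (hq : q ∘ₗ q = 0) (hpq : p ∘ₗ q + q ∘ₗ p = 0) :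
    Function.Injective (iotaBCA p q) ↔
      ker p ⊓ ker q ⊓ (range p ⊔ range q) = range (p ∘ₗ q) := by
  have hp' : ∀ x, p (p x) = 0 := fun x => LinearMap.congr_fun hp x
  have hq' : ∀ x, q (q x) = 0 := fun x => LinearMap.congr_fun hq x
  have hpq' : ∀ x, q (p x) = - p (q x) := fun x =>
    eq_neg_of_add_eq_zero_right (LinearMap.congr_fun hpq x)
  have key : ∀ y : ZBC p q, iotaBCA p q (Submodule.Quotient.mk y) = 0 ↔ (y : V) ∈ BA p q :=
    fun y => Submodule.Quotient.mk_eq_zero _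
  have key2 : ∀ y : ZBC p q, (Submodule.Quotient.mk y : HBC p q) = 0 ↔ (y : V) ∈ BBC p q :=
    fun y => Submodule.Quotient.mk_eq_zero _
  rw [injective_iff_map_eq_zero]
  constructor
  · intro h
    apply le_antisymm
    · rintro z ⟨hz, hz3⟩
      exact (key2 ⟨z, hz⟩).1 (h _ ((key ⟨z, hz⟩).2 hz3))
    · rintro _ ⟨x, rfl⟩
      refine ⟨⟨hp' _, ?_⟩, mem_sup_left ⟨q x, rfl⟩⟩
      change q (p (q x)) = 0
      rw [hpq', hq', map_zero, neg_zero]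
  · intro h a
    obtain ⟨y, rfl⟩ := Submodule.Quotient.mk_surjective _ a
    intro hy
    refine (key2 y).2 ?_
    have : (y : V) ∈ ker p ⊓ ker q ⊓ (range p ⊔ range q) := ⟨y.2, (key y).1 hy⟩
    rw [h] at this
    exact this

theorem aux_s1 {K V : Type*} [Field K] [AddCommGroup V] [Module K V]
    (p q : V →ₗ[K] V) (hp : p ∘ₗ p = 0) (hpq : p ∘ₗ q + q ∘ₗ p = 0) :
    Function.Surjective (iotadelA p q hpq) ↔ ker (p ∘ₗ q) ≤ ker p ⊔ range q := by
  have hp' : ∀ x, p (p x) = 0 := fun x => LinearMap.congr_fun hp x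
  have key : ∀ (y : ker p) (x : ZA p q), iotadelA p q hpq (Submodule.Quotient.mk y) =
      Submodule.Quotient.mk x ↔ (y : V) - x ∈ BA p q :=
    fun y x => Submodule.Quotient.eq _
  constructor
  · intro h x hx
    obtain ⟨a, ha⟩ := h (Submodule.Quotient.mk ⟨x, hx⟩)
    obtain ⟨y, rfl⟩ := Submodule.Quotient.mk_surjective _ a
    obtain ⟨_, ⟨u, rfl⟩, _, ⟨v, rfl⟩, e⟩ := mem_sup.1 ((key y ⟨x, hx⟩).1 ha)
    refine mem_sup.2 ⟨y - p u, sub_mem y.2 (hp' u), q (-v), ⟨-v, rfl⟩, ?_⟩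
    have e' : p u + q v = (y : V) - x := e
    rw [map_neg, eq_sub_of_add_eq' e']
    abel
  · intro h a
    obtain ⟨x, rfl⟩ := Submodule.Quotient.mk_surjective _ a
    obtain ⟨y, hy, w, hw, e⟩ := mem_sup.1 (h x.2)
    refine ⟨Submodule.Quotient.mk ⟨y, hy⟩, (key _ _).2 ?_⟩
    rw [← e]
    refine mem_sup_right ?_
    simpa using hw

theorem aux_s2 {K V : Type*} [Field K] [AddCommGroup V] [Module K V]
    (p q : V →ₗ[K] V) (hq : q ∘ₗ q = 0) :
    Function.Surjective (iotadelbarA p q) ↔ ker (p ∘ₗ q) ≤ ker q ⊔ range p := by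
  have hq' : ∀ x, q (q x) = 0 := fun x => LinearMap.congr_fun hq x
  have key : ∀ (y : ker q) (x : ZA p q), iotadelbarA p q (Submodule.Quotient.mk y) =
      Submodule.Quotient.mk x ↔ (y : V) - x ∈ BA p q :=
    fun y x => Submodule.Quotient.eq _
  constructor
  · intro h x hx
    obtain ⟨a, ha⟩ := h (Submodule.Quotient.mk ⟨x, hx⟩)
    obtain ⟨y, rfl⟩ := Submodule.Quotient.mk_surjective _ a
    obtain ⟨_, ⟨u, rfl⟩, _, ⟨v, rfl⟩, e⟩ := mem_sup.1 ((key y ⟨x, hx⟩).1 ha)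
    refine mem_sup.2 ⟨y - q v, sub_mem y.2 (hq' v), p (-u), ⟨-u, rfl⟩, ?_⟩
    have e' : p u + q v = (y : V) - x := e
    rw [map_neg, eq_sub_of_add_eq' e']
    abel
  · intro h a
    obtain ⟨x, rfl⟩ := Submodule.Quotient.mk_surjective _ a
    obtain ⟨y, hy, w, hw, e⟩ := mem_sup.1 (h x.2)
    refine ⟨Submodule.Quotient.mk ⟨y, hy⟩, (key _ _).2 ?_⟩
    rw [← e]
    refine mem_sup_left ?_
    simpa using hw

/-- The natural map `H_BC → H_A` is injective if and only if both natural maps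
`H_∂ → H_A` and `H_∂̄ → H_A` are surjective; equivalently,
`ker ∂ ∩ ker ∂̄ ∩ (im ∂ + im ∂̄) = im(∂∘∂̄)` holds iff
`ker(∂∘∂̄) ⊆ ker ∂ + im ∂̄` and `ker(∂∘∂̄) ⊆ ker ∂̄ + im ∂`. -/
theorem stmt5 {K V : Type*} [Field K] [AddCommGroup V] [Module K V]
    (p q : V →ₗ[K] V)
    (hp : p ∘ₗ p = 0) (hq : q ∘ₗ q = 0) (hpq : p ∘ₗ q + q ∘ₗ p = 0) :
    (Function.Injective (iotaBCA p q) ↔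
      (Function.Surjective (iotadelA p q hpq) ∧ Function.Surjective (iotadelbarA p q))) ∧
    ((ker p ⊓ ker q ⊓ (range p ⊔ range q) = range (p ∘ₗ q)) ↔
      (ker (p ∘ₗ q) ≤ ker p ⊔ range q ∧ ker (p ∘ₗ q) ≤ ker q ⊔ range p)) := by
  have h := aux_core p q hp hq hpq
  refine ⟨?_, h⟩
  rw [aux_inj p q hp hq hpq, aux_s1 p q hp hpq, aux_s2 p q hq]
  exact h
end

section
/- If the ∂∂̄-Lemma holds, i.e. ker ∂ ∩ ker ∂̄ ∩ (im ∂ + im ∂̄) = im(∂∘∂̄), then the natural map H_d → H_A induced by the identity is surjective; equivalently, ker(∂∘∂̄) ⊆ ker(∂ + ∂̄) + im ∂ + im ∂̄. -/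
open LinearMap Submodule

section

variable {K V : Type*} [Field K] [AddCommGroup V] [Module K V]

theorem kerd_le_ZA (p q : V →ₗ[K] V) (hp : p ∘ₗ p = 0) : ker (p + q) ≤ ZA p q := by
  intro x hx
  rw [LinearMap.mem_ker] at hx
  have hqx : q x = -(p x) := by
    have : p x + q x = 0 := by simpa using hx
    exact eq_neg_of_add_eq_zero_right this
  have hpp : p (p x) = 0 := by
    have := LinearMap.congr_fun hp x; simpa using this
  have : p (q x) = 0 := by rw [hqx, map_neg, hpp, neg_zero]
  simpa [ZA, LinearMap.mem_ker] using this

theorem ranged_le_BA (p q : V →ₗ[K] V) : range (p + q) ≤ BA p q := by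
  rintro x ⟨u, rfl⟩
  have : (p + q) u = p u + q u := rfl
  rw [this]
  exact Submodule.add_mem _ (Submodule.mem_sup_left ⟨u, rfl⟩)
    (Submodule.mem_sup_right ⟨u, rfl⟩)

/-- The natural map `H_dR → H_A` induced by the identity. -/
def iotadA (p q : V →ₗ[K] V) (hp : p ∘ₗ p = 0) :
    (↥(ker (p + q)) ⧸ ((range (p + q)).comap (ker (p + q)).subtype)) →ₗ[K] HA p q :=
  Submodule.liftQ _
    ((Submodule.mkQ _) ∘ₗ Submodule.inclusion (kerd_le_ZA p q hp)) (by
      intro y hy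
      rw [Submodule.mem_comap] at hy
      simp only [LinearMap.mem_ker, LinearMap.comp_apply, Submodule.mkQ_apply,
        Submodule.Quotient.mk_eq_zero, Submodule.mem_comap]
      exact ranged_le_BA p q hy)

end

/-- If the `∂∂̄`-Lemma holds, i.e. `ker ∂ ∩ ker ∂̄ ∩ (im ∂ + im ∂̄) = im(∂∘∂̄)`,
then the natural map `H_dR → H_A` is surjective; equivalently,
`ker(∂∘∂̄) ⊆ ker(∂ + ∂̄) + im ∂ + im ∂̄`. -/
theorem stmt7 {K V : Type*} [Field K] [AddCommGroup V] [Module K V]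
    (p q : V →ₗ[K] V)
    (hp : p ∘ₗ p = 0) (hq : q ∘ₗ q = 0) (hpq : p ∘ₗ q + q ∘ₗ p = 0)
    (hlemma : ker p ⊓ ker q ⊓ (range p ⊔ range q) = range (p ∘ₗ q)) :
    Function.Surjective (iotadA p q hp) ∧
      ker (p ∘ₗ q) ≤ ker (p + q) ⊔ range p ⊔ range q := by
  have key : ∀ x, p (q x) = 0 → ∃ w, (p + q) (x - q w) = 0 := by
    intro x hx
    have hpp : p (p x) = 0 := by simpa using LinearMap.congr_fun hp x
    have hqq : ∀ v, q (q v) = 0 := fun v => by simpa using LinearMap.congr_fun hq v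
    have hqp : q (p x) = 0 := by
      have h : p (q x) + q (p x) = 0 := by simpa using LinearMap.congr_fun hpq x
      rwa [hx, zero_add] at h
    have hmem : p x + q x ∈ range (p ∘ₗ q) := by
      rw [← hlemma]
      refine ⟨⟨?_, ?_⟩, ?_⟩
      · change p (p x + q x) = 0
        rw [map_add, hpp, hx, add_zero]
      · change q (p x + q x) = 0
        rw [map_add, hqp, hqq, add_zero]
      · exact ranged_le_BA p q ⟨x, rfl⟩
    obtain ⟨w, hw⟩ := hmem
    have hw' : p (q w) = p x + q x := hw
    refine ⟨w, ?_⟩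
    rw [map_sub, LinearMap.add_apply, LinearMap.add_apply, hqq, hw', add_zero, sub_self]
  constructor
  · intro y
    obtain ⟨⟨x, hx⟩, rfl⟩ := Submodule.mkQ_surjective _ y
    obtain ⟨w, hw⟩ := key x hx
    refine ⟨Submodule.Quotient.mk ⟨x - q w, hw⟩, ?_⟩
    refine (Submodule.Quotient.eq _).2 ?_
    change (x - q w) - x ∈ BA p q
    have h : (x - q w) - x = q (-w) := by rw [map_neg]; abel
    rw [h]
    exact Submodule.mem_sup_right ⟨_, rfl⟩
  · intro x hx
    obtain ⟨w, hw⟩ := key x hx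
    rw [← sub_add_cancel x (q w)]
    exact Submodule.add_mem_sup (Submodule.mem_sup_left hw) ⟨w, rfl⟩
end
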